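/- In the random environment setting, assume the bounds (H0) and (H) hold uniformly over environments y ∈ S^ℤ. Then there exists a finite constant c, depending only on a, λ, g, such that for all y ∈ S^ℤ and all p ≥ 0, ||Q̄^y_{p,∞}(1) − h^{θ^p(y)}||_∞ ≤ c e^{−λp}. -/

import Mathlib

open MeasureTheory ProbabilityTheory Filter

noncomputable section

namespace FKCLT

variable {E : Type*} [MeasurableSpace E]

/-- Oscillation of a real-valued function. -/
def osc (f : E → ℝ) : ℝ := ⨆ p : E × E, |f p.1 - f p.2|

/-- Total variation distance between two (finite) measures. -/
def tvDist (μ ν : Measure E) : ℝ := ⨆ s : Set E, |(μ s).toReal - (ν s).toReal|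

/-- Normalization of a finite nonzero measure. -/
def normalize (μ : Measure E) : Measure E := (μ Set.univ)⁻¹ • μ

variable (M : ℕ → Kernel E E) (G : ℕ → E → ℝ)

/-- `Qmeas M G p n x` : the Feynman-Kac measure `A ↦ 𝔼[1_A(X_n) ∏_{p≤q<n} G_q(X_q) | X_p = x]`. -/
def Qmeas (p n : ℕ) (x : E) : Measure E :=
  if h : p < n then
    ENNReal.ofReal (G p x) • Measure.bind ((M (p + 1)) x) (fun z => Qmeas (p + 1) n z)
  else Measure.dirac x
termination_by n - p
decreasing_by omega

/-- `Q_{p,n}(f)(x)`. -/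
def Qop (p n : ℕ) (f : E → ℝ) (x : E) : ℝ := ∫ z, f z ∂(Qmeas M G p n x)

variable (η0 : Measure E)

/-- The normalized Feynman-Kac measure `η_n` (with the convention `η_{-1} := η_0`,
realized by `n - 1 = 0` in `ℕ` for `n = 0`). -/
def etaFK (n : ℕ) : Measure E := normalize (Measure.bind η0 (Qmeas M G 0 n))

/-- `Q̄_{p,n}(f) = Q_{p,n}(f) / η_p(Q_{p,n}(1))`. -/
def Qbar (p n : ℕ) (f : E → ℝ) (x : E) : ℝ :=
  Qop M G p n f x / ∫ y, Qop M G p n (fun _ => 1) y ∂(etaFK M G η0 p)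

/-- `d_{p,n}(f) = Q̄_{p,n}(f - η_n(f))`. -/
def dFK (p n : ℕ) (f : E → ℝ) (x : E) : ℝ :=
  Qbar M G η0 p n (fun z => f z - ∫ w, f w ∂(etaFK M G η0 n)) x

/-- `Ḡ_n = G_n / η_n(G_n)`. -/
def Gbar (n : ℕ) (x : E) : ℝ := G n x / ∫ z, G n z ∂(etaFK M G η0 n)

/-- `Φ_{p,n}(μ)`. -/
def PhiFK (p n : ℕ) (μ : Measure E) : Measure E := normalize (Measure.bind μ (Qmeas M G p n))

/-- `Φ_n`, with the convention `Φ_0(μ) = η_0`. -/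
def PhiStep (n : ℕ) (μ : Measure E) : Measure E :=
  if n = 0 then η0 else PhiFK M G (n - 1) n μ

/-- The Markov kernel `P_{p,n}(x, ·) = Q_{p,n}(x,·)/Q_{p,n}(1)(x)`. -/
def PFK (p n : ℕ) (x : E) : Measure E := normalize (Qmeas M G p n x)

/-- The covariance functional `Cov_{n,μ}(f1, f2)`. -/
def CovFn (K : ℕ → Measure E → Kernel E E) (n : ℕ) (μ : Measure E) (f1 f2 : E → ℝ) : ℝ :=
  ∫ x, ((∫ z, f1 z * f2 z ∂((K n μ) x)) -
    (∫ z, f1 z ∂((K n μ) x)) * (∫ z, f2 z ∂((K n μ) x))) ∂μ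

/-- `v_n = Σ_{0 ≤ q < n} Cov_{q, η_{q-1}}(Q̄_{q,n}(1), Q̄_{q,n}(1))`. -/
def vFK (K : ℕ → Measure E → Kernel E E) (n : ℕ) : ℝ :=
  ∑ q ∈ Finset.range n,
    CovFn K q (etaFK M G η0 (q - 1)) (Qbar M G η0 q n (fun _ => 1)) (Qbar M G η0 q n (fun _ => 1))

/-- Empirical measure of an `N`-tuple of points. -/
def empMeas {N : ℕ} (x : Fin N → E) : Measure E :=
  (N : ENNReal)⁻¹ • ∑ i : Fin N, Measure.dirac (x i)

variable {Ω : Type*} [MeasurableSpace Ω]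

/-- σ-algebra generated by the particle system up to time `n`. -/
def partFilt {N : ℕ} (ξ : ℕ → Ω → (Fin N → E)) (n : ℕ) : MeasurableSpace Ω :=
  ⨆ k ∈ Finset.range (n + 1), MeasurableSpace.comap (ξ k) inferInstance

/-- Local error fields `V_n^N`. -/
def VN {N : ℕ} (ξ : ℕ → Ω → (Fin N → E)) (n : ℕ) (f : E → ℝ) (ω : Ω) : ℝ :=
  Real.sqrt N * ((∫ z, f z ∂(empMeas (ξ n ω))) -
    ∫ z, f z ∂(PhiStep M G η0 n (empMeas (ξ (n - 1) ω))))

/-- Global error fields `W_n^N`. -/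
def WN {N : ℕ} (ξ : ℕ → Ω → (Fin N → E)) (n : ℕ) (f : E → ℝ) (ω : Ω) : ℝ :=
  Real.sqrt N * ((∫ z, f z ∂(empMeas (ξ n ω))) - ∫ z, f z ∂(etaFK M G η0 n))

/-- `L^m` norm of a real random variable. -/
def LmNorm (P : Measure Ω) (m : ℕ) (X : Ω → ℝ) : ℝ := (∫ ω, |X ω| ^ m ∂P) ^ ((m : ℝ)⁻¹)


/-- Shift by `m` on the environment space `S^ℤ` (so `shiftEnv 1` is θ and
`shiftEnv m` is `θ^m`). -/
def shiftEnv {S : Type*} (m : ℤ) (y : ℤ → S) : ℤ → S := fun k => y (k + m)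

/-- The environment-indexed Markov kernels `M_n^y := M_{y_n}`. -/
def envM {S : Type*} (Ms : S → Kernel E E) (y : ℤ → S) : ℕ → Kernel E E :=
  fun n => Ms (y (n : ℤ))

/-- The environment-indexed potentials `G_n^y := G_{y_n}`. -/
def envG {S : Type*} (Gs : S → E → ℝ) (y : ℤ → S) : ℕ → E → ℝ :=
  fun n => Gs (y (n : ℤ))

/-- The limiting function `Q̄^y_{p,∞}(1)` defined through the series. -/
def QbarInfEnv {S : Type*} (Ms : S → Kernel E E) (Gs : S → E → ℝ) (η0 : Measure E)
    (y : ℤ → S) (p : ℕ) (x : E) : ℝ :=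
  Real.exp (∑' k : ℕ,
    (Real.log (∫ z, envG Gs y (p + k) z
        ∂(PhiFK (envM Ms y) (envG Gs y) p (p + k) (Measure.dirac x))) -
      Real.log (∫ z, envG Gs y (p + k) z
        ∂(PhiFK (envM Ms y) (envG Gs y) p (p + k) (etaFK (envM Ms y) (envG Gs y) η0 p)))))

/-- The function `h^y`,
`log h^y(x) = Σ_{q≥0} [log Φ^y_{0,q}(δ_x)(G^y_q) - log Φ^y_{0,q}(η_∞^y)(G^y_q)]`. -/
def hEnv {S : Type*} (Ms : S → Kernel E E) (Gs : S → E → ℝ)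
    (ηinf : (ℤ → S) → Measure E) (y : ℤ → S) (x : E) : ℝ :=
  Real.exp (∑' q : ℕ,
    (Real.log (∫ z, envG Gs y q z
        ∂(PhiFK (envM Ms y) (envG Gs y) 0 q (Measure.dirac x))) -
      Real.log (∫ z, envG Gs y q z
        ∂(PhiFK (envM Ms y) (envG Gs y) 0 q (ηinf y)))))

/-! ### Total variation distance -/

theorem abs_toReal_sub_le_one (μ ν : Measure E) [IsProbabilityMeasure μ] [IsProbabilityMeasure ν]
    (s : Set E) : |(μ s).toReal - (ν s).toReal| ≤ 1 := by
  have h1 : μ.real s ≤ 1 := measureReal_le_one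
  have h2 : ν.real s ≤ 1 := measureReal_le_one
  have h3 : 0 ≤ μ.real s := measureReal_nonneg
  have h4 : 0 ≤ ν.real s := measureReal_nonneg
  simp only [Measure.real] at h1 h2 h3 h4
  rw [abs_le]
  constructor <;> linarith

theorem abs_toReal_sub_le_tvDist (μ ν : Measure E) [IsProbabilityMeasure μ]
    [IsProbabilityMeasure ν] (s : Set E) : |(μ s).toReal - (ν s).toReal| ≤ tvDist μ ν :=
  le_ciSup (f := fun s : Set E => |(μ s).toReal - (ν s).toReal|)
    ⟨1, by rintro _ ⟨s, rfl⟩; exact abs_toReal_sub_le_one μ ν s⟩ s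

theorem tvDist_nonneg (μ ν : Measure E) : 0 ≤ tvDist μ ν :=
  Real.iSup_nonneg fun _ => abs_nonneg _

theorem tvDist_le_one (μ ν : Measure E) [IsProbabilityMeasure μ] [IsProbabilityMeasure ν] :
    tvDist μ ν ≤ 1 :=
  ciSup_le fun s => abs_toReal_sub_le_one μ ν s

/-- The supremum defining `tvDist` may be restricted to measurable sets. -/
theorem tvDist_le_of_measurableSet {μ ν : Measure E} {c : ℝ}
    (h : ∀ s, MeasurableSet s → |(μ s).toReal - (ν s).toReal| ≤ c) : tvDist μ ν ≤ c := by
  refine ciSup_le fun s => ?_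
  have hsub : s ⊆ toMeasurable μ s ∩ toMeasurable ν s :=
    Set.subset_inter (subset_toMeasurable μ s) (subset_toMeasurable ν s)
  have hμ : μ (toMeasurable μ s ∩ toMeasurable ν s) = μ s :=
    le_antisymm ((measure_mono Set.inter_subset_left).trans_eq (measure_toMeasurable s))
      (measure_mono hsub)
  have hν : ν (toMeasurable μ s ∩ toMeasurable ν s) = ν s :=
    le_antisymm ((measure_mono Set.inter_subset_right).trans_eq (measure_toMeasurable s))
      (measure_mono hsub)
  rw [← hμ, ← hν]
  exact h _ ((measurableSet_toMeasurable μ s).inter (measurableSet_toMeasurable ν s))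

theorem integrable_of_measurable_of_bounds {μ : Measure E} [IsFiniteMeasure μ] {f : E → ℝ} {C : ℝ}
    (hf : Measurable f) (h0 : ∀ x, 0 ≤ f x) (hC : ∀ x, f x ≤ C) : Integrable f μ :=
  Integrable.of_bound hf.aestronglyMeasurable C
    (ae_of_all _ fun x => by rw [Real.norm_of_nonneg (h0 x)]; exact hC x)

theorem abs_integral_sub_le_mul_tvDist (μ ν : Measure E) [IsProbabilityMeasure μ]
    [IsProbabilityMeasure ν] {f : E → ℝ} {C : ℝ} (hf : Measurable f) (h0 : ∀ x, 0 ≤ f x)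
    (hC : ∀ x, f x ≤ C) : |∫ x, f x ∂μ - ∫ x, f x ∂ν| ≤ C * tvDist μ ν := by
  have hC0 : 0 ≤ C := by
    obtain ⟨x⟩ := nonempty_of_isProbabilityMeasure μ
    exact (h0 x).trans (hC x)
  have key : ∀ ρ : Measure E, [IsProbabilityMeasure ρ] →
      ∫ x, f x ∂ρ = ∫ t in (0 : ℝ)..C, ρ.real {x | t ≤ f x} := by
    intro ρ _
    rw [intervalIntegral.integral_of_le hC0]
    exact (integrable_of_measurable_of_bounds hf h0 hC).integral_eq_integral_Ioc_meas_le
      (ae_of_all _ h0) (ae_of_all _ hC)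
  have hint : ∀ ρ : Measure E, [IsProbabilityMeasure ρ] →
      IntervalIntegrable (fun t => ρ.real {x | t ≤ f x}) volume 0 C := by
    intro ρ _
    refine Antitone.intervalIntegrable fun s t hst => ?_
    exact measureReal_mono fun x (hx : t ≤ f x) => hst.trans hx
  rw [key μ, key ν, ← intervalIntegral.integral_sub (hint μ) (hint ν), ← Real.norm_eq_abs]
  refine (intervalIntegral.norm_integral_le_of_norm_le_const
    (C := tvDist μ ν) fun t _ => ?_).trans_eq ?_
  · exact abs_toReal_sub_le_tvDist μ ν _
  · rw [sub_zero, abs_of_nonneg hC0, mul_comm]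

theorem isProbabilityMeasure_normalize {μ : Measure E} (h0 : μ Set.univ ≠ 0)
    (h1 : μ Set.univ ≠ ⊤) : IsProbabilityMeasure (normalize μ) :=
  ⟨by simp only [normalize, Measure.smul_apply, smul_eq_mul]; exact ENNReal.inv_mul_cancel h0 h1⟩

theorem integral_pos_of_pos {μ : Measure E} [IsProbabilityMeasure μ] {f : E → ℝ}
    (hi : Integrable f μ) (h0 : ∀ x, 0 < f x) : 0 < ∫ x, f x ∂μ := by
  rw [integral_pos_iff_support_of_nonneg (fun x => (h0 x).le) hi]
  simp [Function.support, (h0 _).ne']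

theorem integrable_of_le_mul {μ : Measure E} [IsProbabilityMeasure μ] {f : E → ℝ} {R : ℝ}
    (hf : Measurable f) (h0 : ∀ x, 0 < f x) (hR : ∀ x y, f x ≤ R * f y) : Integrable f μ := by
  obtain ⟨x₀⟩ := nonempty_of_isProbabilityMeasure μ
  exact integrable_of_measurable_of_bounds hf (fun x => (h0 x).le) fun x => hR x x₀

theorem le_mul_integral {μ : Measure E} [IsProbabilityMeasure μ] {f : E → ℝ} {R : ℝ}
    (hf : Measurable f) (h0 : ∀ x, 0 < f x) (hR : ∀ x y, f x ≤ R * f y) (x : E) :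
    f x ≤ R * ∫ y, f y ∂μ := by
  have hi : Integrable f μ := integrable_of_le_mul hf h0 hR
  have h := integral_mono (μ := μ) (integrable_const (f x)) (hi.const_mul R) fun y => hR x y
  rwa [integral_const, probReal_univ, one_smul, integral_const_mul] at h

theorem integral_le_exp_mul_integral (μ ν : Measure E) [IsProbabilityMeasure μ]
    [IsProbabilityMeasure ν] {f : E → ℝ} {g : ℝ} (hf : Measurable f) (h0 : ∀ x, 0 < f x)
    (hg : ∀ x y, f x ≤ g * f y) :
    ∫ x, f x ∂μ ≤ Real.exp (g * tvDist μ ν) * ∫ x, f x ∂ν := by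
  have hpos := integral_pos_of_pos (integrable_of_le_mul (μ := ν) hf h0 hg) h0
  have h := (abs_le.mp (abs_integral_sub_le_mul_tvDist μ ν hf (fun x => (h0 x).le)
    (le_mul_integral (μ := ν) hf h0 hg))).2
  nlinarith [Real.add_one_le_exp (g * tvDist μ ν)]

theorem tvDist_comm (μ ν : Measure E) : tvDist μ ν = tvDist ν μ := by
  simp only [tvDist, abs_sub_comm]

theorem abs_log_integral_sub_le (μ ν : Measure E) [IsProbabilityMeasure μ]
    [IsProbabilityMeasure ν] {f : E → ℝ} {g : ℝ} (hf : Measurable f) (h0 : ∀ x, 0 < f x)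
    (hg : ∀ x y, f x ≤ g * f y) :
    |Real.log (∫ x, f x ∂μ) - Real.log (∫ x, f x ∂ν)| ≤ g * tvDist μ ν := by
  have key : ∀ ρ σ : Measure E, [IsProbabilityMeasure ρ] → [IsProbabilityMeasure σ] →
      Real.log (∫ x, f x ∂ρ) ≤ g * tvDist ρ σ + Real.log (∫ x, f x ∂σ) := by
    intro ρ σ _ _
    have h := Real.log_le_log (integral_pos_of_pos (integrable_of_le_mul hf h0 hg) h0)
      (integral_le_exp_mul_integral ρ σ hf h0 hg)
    rwa [Real.log_mul (Real.exp_ne_zero _)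
      (integral_pos_of_pos (integrable_of_le_mul hf h0 hg) h0).ne', Real.log_exp] at h
  have h1 := key μ ν
  have h2 := key ν μ
  rw [tvDist_comm] at h2
  rw [abs_le]
  constructor <;> linarith

/-- Reweighting by a density with ratio of values at most `R` is `2 R`-Lipschitz in total
variation. -/
theorem tvDist_normalize_withDensity_le (μ ν : Measure E) [IsProbabilityMeasure μ]
    [IsProbabilityMeasure ν] {f : E → ℝ} {R : ℝ} (hf : Measurable f) (h0 : ∀ x, 0 < f x)
    (hR : ∀ x y, f x ≤ R * f y) :
    tvDist (normalize (μ.withDensity fun x => ENNReal.ofReal (f x)))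
      (normalize (ν.withDensity fun x => ENNReal.ofReal (f x))) ≤ 2 * R * tvDist μ ν := by
  have hi : ∀ ρ : Measure E, [IsProbabilityMeasure ρ] → Integrable f ρ := fun ρ _ =>
    integrable_of_le_mul hf h0 hR
  have hC := le_mul_integral (μ := μ) hf h0 hR
  have hm := integral_pos_of_pos (hi μ) h0
  have hn := integral_pos_of_pos (hi ν) h0
  have happ : ∀ ρ : Measure E, [IsProbabilityMeasure ρ] → ∀ s, MeasurableSet s →
      (normalize (ρ.withDensity fun x => ENNReal.ofReal (f x)) s).toReal
        = (∫ x, s.indicator f x ∂ρ) / ∫ x, f x ∂ρ := by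
    intro ρ _ s hs
    rw [normalize, Measure.smul_apply, smul_eq_mul, withDensity_apply _ hs,
      withDensity_apply _ MeasurableSet.univ, Measure.restrict_univ, ENNReal.toReal_mul,
      ENNReal.toReal_inv, integral_indicator hs,
      integral_eq_lintegral_of_nonneg_ae (ae_of_all _ fun x => (h0 x).le)
        hf.aestronglyMeasurable,
      integral_eq_lintegral_of_nonneg_ae (ae_of_all _ fun x => (h0 x).le)
        hf.aestronglyMeasurable, div_eq_inv_mul]
  refine tvDist_le_of_measurableSet fun s hs => ?_
  rw [happ μ s hs, happ ν s hs]
  have hind0 : ∀ x, 0 ≤ s.indicator f x := fun x =>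
    Set.indicator_nonneg (fun x _ => (h0 x).le) x
  have hindle : ∀ x, s.indicator f x ≤ f x := fun x =>
    Set.indicator_le_self' (fun x _ => (h0 x).le) x
  have hA := abs_integral_sub_le_mul_tvDist μ ν (hf.indicator hs) hind0
    (fun x => (hindle x).trans (hC x))
  have hB := abs_integral_sub_le_mul_tvDist ν μ hf (fun x => (h0 x).le) hC
  have hBs : ∫ x, s.indicator f x ∂ν ≤ ∫ x, f x ∂ν :=
    integral_mono ((hi ν).indicator hs) (hi ν) hindle
  have hB0 : 0 ≤ ∫ x, s.indicator f x ∂ν := integral_nonneg hind0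
  rw [tvDist_comm ν μ] at hB
  set A := ∫ x, s.indicator f x ∂μ
  set B := ∫ x, s.indicator f x ∂ν
  set m := ∫ x, f x ∂μ
  set n := ∫ x, f x ∂ν
  have hsplit : A / m - B / n = (A - B) / m + B / n * ((n - m) / m) := by
    field_simp
    ring
  have hA' : |(A - B) / m| ≤ R * tvDist μ ν := by
    rw [abs_div, abs_of_pos hm, div_le_iff₀ hm]
    linarith
  have hB' : |(n - m) / m| ≤ R * tvDist μ ν := by
    rw [abs_div, abs_of_pos hm, div_le_iff₀ hm]
    linarith
  have hBn : |B / n| ≤ 1 := by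
    rw [abs_of_nonneg (div_nonneg hB0 hn.le)]
    exact (div_le_one hn).mpr hBs
  calc |A / m - B / n| ≤ |(A - B) / m| + |B / n| * |(n - m) / m| := by
        rw [hsplit, ← abs_mul]
        exact abs_add_le _ _
    _ ≤ R * tvDist μ ν + 1 * (R * tvDist μ ν) := by gcongr
    _ = 2 * R * tvDist μ ν := by ring

/-! ### Feynman-Kac measures -/

section FeynmanKac

variable {M : ℕ → Kernel E E} {G : ℕ → E → ℝ}

theorem Qmeas_self (p : ℕ) (x : E) : Qmeas M G p p x = Measure.dirac x := by
  rw [Qmeas, dif_neg (lt_irrefl p)]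

theorem Qmeas_of_lt {p n : ℕ} (h : p < n) (x : E) :
    Qmeas M G p n x = ENNReal.ofReal (G p x) • Measure.bind (M (p + 1) x) (Qmeas M G (p + 1) n) := by
  rw [Qmeas, dif_pos h]

theorem Qmeas_of_not_lt {p n : ℕ} (h : ¬ p < n) (x : E) : Qmeas M G p n x = Measure.dirac x := by
  rw [Qmeas, dif_neg h]

/-- Time-homogeneity of the construction: shifting the model shifts the time indices. -/
theorem Qmeas_shift (m p n : ℕ) (x : E) :
    Qmeas (fun i => M (i + m)) (fun i => G (i + m)) p n x = Qmeas M G (p + m) (n + m) x := by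
  by_cases h : p < n
  · rw [Qmeas_of_lt h, Qmeas_of_lt (by omega : p + m < n + m)]
    have : Qmeas (fun i => M (i + m)) (fun i => G (i + m)) (p + 1) n
        = Qmeas M G (p + m + 1) (n + m) := by
      funext z
      rw [Qmeas_shift m (p + 1) n z, add_right_comm]
    rw [this, add_right_comm]
  · rw [Qmeas_of_not_lt h, Qmeas_of_not_lt (by omega)]
termination_by n - p
decreasing_by omega

theorem measurable_Qmeas (hG : ∀ n, Measurable (G n)) (p n : ℕ) : Measurable (Qmeas M G p n) := by
  by_cases h : p < n
  · have ih := measurable_Qmeas hG (p + 1) n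
    have hb : Measurable fun x => Measure.bind (M (p + 1) x) (Qmeas M G (p + 1) n) :=
      (Measure.measurable_bind' ih).comp (M (p + 1)).measurable
    refine Measure.measurable_of_measurable_coe _ fun s hs => ?_
    simp only [Qmeas_of_lt h, Measure.smul_apply, smul_eq_mul]
    exact (hG p).ennreal_ofReal.mul ((Measure.measurable_coe hs).comp hb)
  · have : Qmeas M G p n = Measure.dirac := funext fun x => Qmeas_of_not_lt h x
    rw [this]
    exact Measure.measurable_dirac
termination_by n - p
decreasing_by omega

/-- Standing assumptions on the model: Markov transitions, and measurable positive potentials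
whose values are comparable up to the factor `g`. -/
structure IsBoundedModel (M : ℕ → Kernel E E) (G : ℕ → E → ℝ) (g : ℝ) : Prop where
  markov : ∀ n, IsMarkovKernel (M n)
  measurable : ∀ n, Measurable (G n)
  pos : ∀ n x, 0 < G n x
  le_mul : ∀ n x y, G n x ≤ g * G n y

variable {g : ℝ}

theorem Qmeas_univ_of_lt (h : IsBoundedModel M G g) {p n : ℕ} (hpn : p < n) (x : E) :
    Qmeas M G p n x Set.univ
      = ENNReal.ofReal (G p x) * ∫⁻ z, Qmeas M G (p + 1) n z Set.univ ∂(M (p + 1) x) := by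
  rw [Qmeas_of_lt hpn, Measure.smul_apply, smul_eq_mul,
    Measure.bind_apply MeasurableSet.univ (measurable_Qmeas h.measurable _ _).aemeasurable]

theorem exists_bounds_Qmeas_univ (h : IsBoundedModel M G g) (p n : ℕ) :
    ∃ l u : ENNReal, l ≠ 0 ∧ u ≠ ⊤ ∧
      ∀ x, l ≤ Qmeas M G p n x Set.univ ∧ Qmeas M G p n x Set.univ ≤ u := by
  by_cases hpn : p < n
  · rcases isEmpty_or_nonempty E with hE | ⟨⟨x₀⟩⟩
    · exact ⟨1, 1, one_ne_zero, ENNReal.one_ne_top, fun x => hE.elim x⟩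
    obtain ⟨l, u, hl, hu, hlu⟩ := exists_bounds_Qmeas_univ h (p + 1) n
    have hg : 0 < g := by
      have h1 := h.le_mul p x₀ x₀
      have h2 := h.pos p x₀
      by_contra hneg
      nlinarith
    refine ⟨ENNReal.ofReal (G p x₀ / g) * l, ENNReal.ofReal (g * G p x₀) * u, ?_, ?_, fun x => ?_⟩
    · refine mul_ne_zero ?_ hl
      have := div_pos (h.pos p x₀) hg
      simpa using this
    · exact ENNReal.mul_ne_top ENNReal.ofReal_ne_top hu
    · have := h.markov (p + 1)
      rw [Qmeas_univ_of_lt h hpn]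
      constructor
      · refine mul_le_mul' (ENNReal.ofReal_le_ofReal ?_) ?_
        · rw [div_le_iff₀ hg, mul_comm]
          exact h.le_mul p x₀ x
        · calc l = ∫⁻ _, l ∂(M (p + 1) x) := by simp
            _ ≤ _ := lintegral_mono fun z => (hlu z).1
      · refine mul_le_mul' (ENNReal.ofReal_le_ofReal (h.le_mul p x x₀)) ?_
        calc _ ≤ ∫⁻ _, u ∂(M (p + 1) x) := lintegral_mono fun z => (hlu z).2
          _ = u := by simp
  · refine ⟨1, 1, one_ne_zero, ENNReal.one_ne_top, fun x => ?_⟩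
    simp [Qmeas_of_not_lt hpn]
termination_by n - p
decreasing_by omega

theorem Qmeas_univ_ne_zero (h : IsBoundedModel M G g) (p n : ℕ) (x : E) :
    Qmeas M G p n x Set.univ ≠ 0 := by
  obtain ⟨l, _, hl, _, hlu⟩ := exists_bounds_Qmeas_univ h p n
  exact fun h0 => hl (nonpos_iff_eq_zero.mp (h0 ▸ (hlu x).1))

theorem Qmeas_univ_ne_top (h : IsBoundedModel M G g) (p n : ℕ) (x : E) :
    Qmeas M G p n x Set.univ ≠ ⊤ := by
  obtain ⟨_, u, _, hu, hlu⟩ := exists_bounds_Qmeas_univ h p n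
  exact ne_top_of_le_ne_top hu (hlu x).2

theorem measurable_Qmeas_univ (h : IsBoundedModel M G g) (p n : ℕ) :
    Measurable fun x => Qmeas M G p n x Set.univ :=
  (Measure.measurable_coe MeasurableSet.univ).comp (measurable_Qmeas h.measurable p n)

theorem lintegral_Qmeas_univ_ne_zero (h : IsBoundedModel M G g) (p n : ℕ) (μ : Measure E)
    [IsProbabilityMeasure μ] : ∫⁻ x, Qmeas M G p n x Set.univ ∂μ ≠ 0 := by
  obtain ⟨l, _, hl, _, hlu⟩ := exists_bounds_Qmeas_univ h p n
  refine fun h0 => hl (nonpos_iff_eq_zero.mp ?_)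
  calc l = ∫⁻ _, l ∂μ := by simp
    _ ≤ ∫⁻ x, Qmeas M G p n x Set.univ ∂μ := lintegral_mono fun x => (hlu x).1
    _ = 0 := h0

theorem lintegral_Qmeas_univ_ne_top (h : IsBoundedModel M G g) (p n : ℕ) (μ : Measure E)
    [IsProbabilityMeasure μ] : ∫⁻ x, Qmeas M G p n x Set.univ ∂μ ≠ ⊤ := by
  obtain ⟨_, u, _, hu, hlu⟩ := exists_bounds_Qmeas_univ h p n
  refine ne_top_of_le_ne_top hu ?_
  calc ∫⁻ x, Qmeas M G p n x Set.univ ∂μ ≤ ∫⁻ _, u ∂μ := lintegral_mono fun x => (hlu x).2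
    _ = u := by simp

theorem isProbabilityMeasure_PhiFK (h : IsBoundedModel M G g) (p n : ℕ) (μ : Measure E)
    [IsProbabilityMeasure μ] : IsProbabilityMeasure (PhiFK M G p n μ) := by
  have hb := Measure.bind_apply (m := μ) MeasurableSet.univ
    (measurable_Qmeas (M := M) h.measurable p n).aemeasurable
  refine isProbabilityMeasure_normalize ?_ ?_
  · rw [hb]; exact lintegral_Qmeas_univ_ne_zero h p n μ
  · rw [hb]; exact lintegral_Qmeas_univ_ne_top h p n μ

theorem measurable_PFK (h : IsBoundedModel M G g) (p n : ℕ) : Measurable (PFK M G p n) := by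
  refine Measure.measurable_of_measurable_coe _ fun s hs => ?_
  simp only [PFK, normalize, Measure.smul_apply, smul_eq_mul]
  exact (measurable_Qmeas_univ h p n).inv.mul
    ((Measure.measurable_coe hs).comp (measurable_Qmeas h.measurable p n))

/-- The nonlinear semigroup is a reweighting by the total mass followed by the Markov kernel
`P_{p,n}`. -/
theorem PhiFK_eq_bind (h : IsBoundedModel M G g) (p n : ℕ) (μ : Measure E) :
    PhiFK M G p n μ = Measure.bind
      (normalize (μ.withDensity fun x => Qmeas M G p n x Set.univ)) (PFK M G p n) := by
  have hmq := measurable_Qmeas (M := M) h.measurable p n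
  have hmu := measurable_Qmeas_univ h p n
  ext s hs
  have hms : Measurable fun x => PFK M G p n x s :=
    (Measure.measurable_coe hs).comp (measurable_PFK h p n)
  rw [PhiFK, normalize, Measure.smul_apply, Measure.bind_apply hs hmq.aemeasurable,
    Measure.bind_apply MeasurableSet.univ hmq.aemeasurable,
    Measure.bind_apply hs (measurable_PFK h p n).aemeasurable, normalize, lintegral_smul_measure,
    withDensity_apply _ MeasurableSet.univ, Measure.restrict_univ,
    lintegral_withDensity_eq_lintegral_mul _ hmu hms]
  congr 1
  refine lintegral_congr fun x => ?_
  rw [Pi.mul_apply, PFK, normalize, Measure.smul_apply, smul_eq_mul, ← mul_assoc,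
    ENNReal.mul_inv_cancel (Qmeas_univ_ne_zero h p n x) (Qmeas_univ_ne_top h p n x), one_mul]

theorem PFK_eq_PhiFK_dirac (h : IsBoundedModel M G g) (p n : ℕ) (x : E) :
    PFK M G p n x = PhiFK M G p n (Measure.dirac x) := by
  rw [PFK, PhiFK, Measure.dirac_bind (measurable_Qmeas h.measurable p n)]

/-- Adding one final potential to the Feynman-Kac measure. -/
theorem Qmeas_succ_univ (h : IsBoundedModel M G g) {p n : ℕ} (hpn : p ≤ n) (x : E) :
    Qmeas M G p (n + 1) x Set.univ = ∫⁻ z, ENNReal.ofReal (G n z) ∂(Qmeas M G p n x) := by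
  have hGm := (h.measurable n).ennreal_ofReal
  rw [Qmeas_univ_of_lt h (Nat.lt_succ_of_le hpn)]
  rcases hpn.eq_or_lt with rfl | hlt
  · have := h.markov (p + 1)
    simp [Qmeas_self, lintegral_dirac' _ hGm]
  · rw [Qmeas_of_lt hlt, lintegral_smul_measure, smul_eq_mul,
      Measure.lintegral_bind (measurable_Qmeas h.measurable _ _).aemeasurable hGm.aemeasurable]
    congr 1
    exact lintegral_congr fun z => Qmeas_succ_univ h hlt z
termination_by n - p
decreasing_by omega

theorem toReal_Qmeas_succ_univ (h : IsBoundedModel M G g) {p n : ℕ} (hpn : p ≤ n) (x : E) :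
    (Qmeas M G p (n + 1) x Set.univ).toReal
      = (Qmeas M G p n x Set.univ).toReal * ∫ z, G n z ∂(PFK M G p n x) := by
  rw [PFK, normalize, integral_smul_measure, smul_eq_mul, ENNReal.toReal_inv, ← mul_assoc,
    mul_inv_cancel₀ (ENNReal.toReal_ne_zero.mpr
      ⟨Qmeas_univ_ne_zero h p n x, Qmeas_univ_ne_top h p n x⟩), one_mul, Qmeas_succ_univ h hpn,
    integral_eq_lintegral_of_nonneg_ae (ae_of_all _ fun z => (h.pos n z).le)
      (h.measurable n).aestronglyMeasurable]

/-- Geometric contraction in total variation of the Markov kernels `P_{p,p+k}`. -/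
def IsContracting (M : ℕ → Kernel E E) (G : ℕ → E → ℝ) (a r : ℝ) : Prop :=
  ∀ p k : ℕ, ∀ μ ν : Measure E, IsProbabilityMeasure μ → IsProbabilityMeasure ν →
    tvDist (Measure.bind μ (PFK M G p (p + k))) (Measure.bind ν (PFK M G p (p + k)))
      ≤ a * r ^ k * tvDist μ ν

variable {a r : ℝ}

theorem isProbabilityMeasure_reweight (h : IsBoundedModel M G g) (p n : ℕ) (μ : Measure E)
    [IsProbabilityMeasure μ] :
    IsProbabilityMeasure (normalize (μ.withDensity fun x => Qmeas M G p n x Set.univ)) := by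
  apply isProbabilityMeasure_normalize <;>
    rw [withDensity_apply _ MeasurableSet.univ, Measure.restrict_univ]
  · exact lintegral_Qmeas_univ_ne_zero h p n μ
  · exact lintegral_Qmeas_univ_ne_top h p n μ

theorem tvDist_PhiFK_le_reweight (h : IsBoundedModel M G g) (hc : IsContracting M G a r)
    (p k : ℕ) (μ ν : Measure E) [IsProbabilityMeasure μ] [IsProbabilityMeasure ν] :
    tvDist (PhiFK M G p (p + k) μ) (PhiFK M G p (p + k) ν) ≤ a * r ^ k *
      tvDist (normalize (μ.withDensity fun x => Qmeas M G p (p + k) x Set.univ))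
        (normalize (ν.withDensity fun x => Qmeas M G p (p + k) x Set.univ)) := by
  rw [PhiFK_eq_bind h, PhiFK_eq_bind h]
  exact hc p k _ _ (isProbabilityMeasure_reweight h p _ μ) (isProbabilityMeasure_reweight h p _ ν)

theorem tvDist_PhiFK_le (h : IsBoundedModel M G g) (hc : IsContracting M G a r) (ha : 0 ≤ a)
    (hr : 0 ≤ r) (p k : ℕ) (μ ν : Measure E) [IsProbabilityMeasure μ] [IsProbabilityMeasure ν] :
    tvDist (PhiFK M G p (p + k) μ) (PhiFK M G p (p + k) ν) ≤ a * r ^ k := by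
  have := isProbabilityMeasure_reweight h p (p + k) μ
  have := isProbabilityMeasure_reweight h p (p + k) ν
  exact (tvDist_PhiFK_le_reweight h hc p k μ ν).trans
    (mul_le_of_le_one_right (by positivity) (tvDist_le_one _ _))

theorem toReal_Qmeas_univ_le_mul (h : IsBoundedModel M G g) (hc : IsContracting M G a r)
    (ha : 0 ≤ a) (hg : 0 ≤ g) (hr : 0 ≤ r) (hr1 : r < 1) (p k : ℕ) (x y : E) :
    (Qmeas M G p (p + k) x Set.univ).toReal
      ≤ Real.exp (g * a * (1 - r)⁻¹) * (Qmeas M G p (p + k) y Set.univ).toReal := by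
  have key : ∀ k : ℕ, (Qmeas M G p (p + k) x Set.univ).toReal
      ≤ Real.exp (g * a * ∑ i ∈ Finset.range k, r ^ i)
        * (Qmeas M G p (p + k) y Set.univ).toReal := by
    intro k
    induction k with
    | zero => simp [Qmeas_self]
    | succ k ih =>
      have hPx := isProbabilityMeasure_PhiFK h p (p + k) (Measure.dirac x)
      have hPy := isProbabilityMeasure_PhiFK h p (p + k) (Measure.dirac y)
      have hxy := integral_le_exp_mul_integral (PhiFK M G p (p + k) (Measure.dirac x))
        (PhiFK M G p (p + k) (Measure.dirac y)) (h.measurable (p + k)) (h.pos _) (h.le_mul _)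
      have htv := tvDist_PhiFK_le h hc ha hr p k (Measure.dirac x) (Measure.dirac y)
      have hpos : 0 ≤ ∫ z, G (p + k) z ∂(PhiFK M G p (p + k) (Measure.dirac y)) :=
        integral_nonneg fun z => (h.pos _ z).le
      have hpos' : 0 ≤ ∫ z, G (p + k) z ∂(PhiFK M G p (p + k) (Measure.dirac x)) :=
        integral_nonneg fun z => (h.pos _ z).le
      rw [← add_assoc, toReal_Qmeas_succ_univ h (Nat.le_add_right p k),
        toReal_Qmeas_succ_univ h (Nat.le_add_right p k), PFK_eq_PhiFK_dirac h,
        PFK_eq_PhiFK_dirac h, Finset.sum_range_succ, mul_add, Real.exp_add]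
      have hstep : ∫ z, G (p + k) z ∂(PhiFK M G p (p + k) (Measure.dirac x))
          ≤ Real.exp (g * a * r ^ k)
            * ∫ z, G (p + k) z ∂(PhiFK M G p (p + k) (Measure.dirac y)) := by
        refine hxy.trans (mul_le_mul_of_nonneg_right (Real.exp_le_exp.mpr ?_) hpos)
        rw [mul_assoc]
        exact mul_le_mul_of_nonneg_left htv hg
      refine (mul_le_mul ih hstep hpos' (by positivity)).trans_eq ?_
      ring
  refine (key k).trans (mul_le_mul_of_nonneg_right (Real.exp_le_exp.mpr ?_) ENNReal.toReal_nonneg)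
  refine mul_le_mul_of_nonneg_left ?_ (mul_nonneg hg ha)
  rw [← tsum_geometric_of_lt_one hr hr1]
  exact (summable_geometric_of_lt_one hr hr1).sum_le_tsum _ fun i _ => pow_nonneg hr i

theorem tvDist_PhiFK_le_mul_tvDist (h : IsBoundedModel M G g) (hc : IsContracting M G a r)
    (ha : 0 ≤ a) (hg : 0 ≤ g) (hr : 0 ≤ r) (hr1 : r < 1) (p k : ℕ) (μ ν : Measure E)
    [IsProbabilityMeasure μ] [IsProbabilityMeasure ν] :
    tvDist (PhiFK M G p (p + k) μ) (PhiFK M G p (p + k) ν)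
      ≤ a * r ^ k * (2 * Real.exp (g * a * (1 - r)⁻¹) * tvDist μ ν) := by
  refine (tvDist_PhiFK_le_reweight h hc p k μ ν).trans
    (mul_le_mul_of_nonneg_left ?_ (by positivity))
  have hof : (fun x => Qmeas M G p (p + k) x Set.univ)
      = fun x => ENNReal.ofReal (Qmeas M G p (p + k) x Set.univ).toReal :=
    funext fun x => (ENNReal.ofReal_toReal (Qmeas_univ_ne_top h p (p + k) x)).symm
  rw [hof]
  exact tvDist_normalize_withDensity_le μ ν (measurable_Qmeas_univ h p (p + k)).ennreal_toReal
    (fun x => ENNReal.toReal_pos (Qmeas_univ_ne_zero h p _ x) (Qmeas_univ_ne_top h p _ x))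
    (toReal_Qmeas_univ_le_mul h hc ha hg hr hr1 p k)

theorem abs_log_integral_PhiFK_sub_le (h : IsBoundedModel M G g) (p n : ℕ) (μ ν : Measure E)
    [IsProbabilityMeasure μ] [IsProbabilityMeasure ν] :
    |Real.log (∫ z, G n z ∂(PhiFK M G p n μ)) - Real.log (∫ z, G n z ∂(PhiFK M G p n ν))|
      ≤ g * tvDist (PhiFK M G p n μ) (PhiFK M G p n ν) := by
  have := isProbabilityMeasure_PhiFK h p n μ
  have := isProbabilityMeasure_PhiFK h p n ν
  exact abs_log_integral_sub_le _ _ (h.measurable n) (h.pos n) (h.le_mul n)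

theorem abs_exp_sub_exp_le {s t C : ℝ} (hs : s ≤ C) (ht : t ≤ C) :
    |Real.exp s - Real.exp t| ≤ Real.exp C * |s - t| := by
  have key : ∀ {u v : ℝ}, u ≤ C → Real.exp u - Real.exp v ≤ Real.exp C * |u - v| := by
    intro u v hu
    have h1 : Real.exp v = Real.exp u * Real.exp (v - u) := by rw [← Real.exp_add]; ring_nf
    calc Real.exp u - Real.exp v ≤ Real.exp u * (u - v) := by
          rw [h1]
          nlinarith [Real.add_one_le_exp (v - u), Real.exp_pos u]
      _ ≤ Real.exp u * |u - v| := by gcongr; exact le_abs_self _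
      _ ≤ Real.exp C * |u - v| := by gcongr
  rw [abs_sub_le_iff]
  exact ⟨key hs, abs_sub_comm s t ▸ key ht⟩

/-- The limit of the normalized Feynman-Kac masses started from `x` at time `p`, as defined by its
logarithmic series, depends in a Lipschitz way on the centring distribution. -/
theorem abs_exp_tsum_sub_le (h : IsBoundedModel M G g) (hc : IsContracting M G a r)
    (ha : 0 ≤ a) (hg : 0 ≤ g) (hr : 0 ≤ r) (hr1 : r < 1) (p : ℕ) (x : E) (μ ν : Measure E)
    [IsProbabilityMeasure μ] [IsProbabilityMeasure ν] :
    |Real.exp (∑' k : ℕ, (Real.log (∫ z, G (p + k) z ∂(PhiFK M G p (p + k) (Measure.dirac x)))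
          - Real.log (∫ z, G (p + k) z ∂(PhiFK M G p (p + k) μ))))
      - Real.exp (∑' k : ℕ, (Real.log (∫ z, G (p + k) z ∂(PhiFK M G p (p + k) (Measure.dirac x)))
          - Real.log (∫ z, G (p + k) z ∂(PhiFK M G p (p + k) ν))))|
      ≤ 2 * (g * a * (1 - r)⁻¹) * Real.exp (g * a * (1 - r)⁻¹) ^ 2 * tvDist μ ν := by
  set L : Measure E → ℕ → ℝ :=
    fun ρ k => Real.log (∫ z, G (p + k) z ∂(PhiFK M G p (p + k) ρ)) with hL
  change |Real.exp (∑' k, (L (Measure.dirac x) k - L μ k))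
    - Real.exp (∑' k, (L (Measure.dirac x) k - L ν k))| ≤ _
  have hgeo : HasSum (fun k : ℕ => g * a * r ^ k) (g * a * (1 - r)⁻¹) :=
    (hasSum_geometric_of_lt_one hr hr1).mul_left _
  have hbound : ∀ ρ σ : Measure E, [IsProbabilityMeasure ρ] → [IsProbabilityMeasure σ] → ∀ k,
      ‖L ρ k - L σ k‖ ≤ g * a * r ^ k := by
    intro ρ σ _ _ k
    refine (abs_log_integral_PhiFK_sub_le h p (p + k) ρ σ).trans ?_
    rw [mul_assoc]
    exact mul_le_mul_of_nonneg_left (tvDist_PhiFK_le h hc ha hr p k ρ σ) hg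
  have hsum : ∀ ρ σ : Measure E, [IsProbabilityMeasure ρ] → [IsProbabilityMeasure σ] →
      Summable fun k => L ρ k - L σ k := fun ρ σ _ _ =>
    Summable.of_norm_bounded hgeo.summable (hbound ρ σ)
  have hle : ∀ ρ : Measure E, [IsProbabilityMeasure ρ] →
      ∑' k, (L (Measure.dirac x) k - L ρ k) ≤ g * a * (1 - r)⁻¹ := fun ρ _ =>
    (le_abs_self _).trans (tsum_of_norm_bounded hgeo (hbound _ ρ))
  refine (abs_exp_sub_exp_le (hle μ) (hle ν)).trans ?_
  rw [← (hsum _ μ).tsum_sub (hsum _ ν)]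
  have hdiff : ∀ k, ‖L (Measure.dirac x) k - L μ k - (L (Measure.dirac x) k - L ν k)‖
      ≤ g * a * r ^ k * (2 * Real.exp (g * a * (1 - r)⁻¹) * tvDist μ ν) := by
    intro k
    rw [sub_sub_sub_cancel_left, norm_sub_rev]
    refine (abs_log_integral_PhiFK_sub_le h p (p + k) μ ν).trans ?_
    rw [mul_assoc g, mul_assoc g]
    exact mul_le_mul_of_nonneg_left (tvDist_PhiFK_le_mul_tvDist h hc ha hg hr hr1 p k μ ν) hg
  refine (mul_le_mul_of_nonneg_left (tsum_of_norm_bounded (hgeo.mul_right _) hdiff)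
    (Real.exp_pos _).le).trans_eq ?_
  ring

end FeynmanKac

section Environment

variable {S : Type*} {Ms : S → Kernel E E} {Gs : S → E → ℝ}

theorem shiftEnv_neg_shiftEnv (m : ℤ) (y : ℤ → S) : shiftEnv (-m) (shiftEnv m y) = y := by
  funext k
  simp [shiftEnv]

theorem Qmeas_shiftEnv (y : ℤ → S) (m p n : ℕ) :
    Qmeas (envM Ms (shiftEnv m y)) (envG Gs (shiftEnv m y)) p n
      = Qmeas (envM Ms y) (envG Gs y) (p + m) (n + m) := by
  funext x
  have hM : envM Ms (shiftEnv m y) = fun i => envM Ms y (i + m) := by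
    funext i
    simp only [envM, shiftEnv, Nat.cast_add]
  have hG : envG Gs (shiftEnv m y) = fun i => envG Gs y (i + m) := by
    funext i
    simp only [envG, shiftEnv, Nat.cast_add]
  rw [← Qmeas_shift, hM, hG]

/-- The function `h` in the environment shifted by `p` is a series of the same kind as
`Q̄_{p,∞}(1)`, but centred at the limiting measure. -/
theorem hEnv_shiftEnv (ηinf : (ℤ → S) → Measure E) (y : ℤ → S) (p : ℕ) (x : E) :
    hEnv Ms Gs ηinf (shiftEnv p y) x = Real.exp (∑' k : ℕ,
      (Real.log (∫ z, envG Gs y (p + k) z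
        ∂(PhiFK (envM Ms y) (envG Gs y) p (p + k) (Measure.dirac x))) -
      Real.log (∫ z, envG Gs y (p + k) z
        ∂(PhiFK (envM Ms y) (envG Gs y) p (p + k) (ηinf (shiftEnv p y)))))) := by
  have hG : ∀ k : ℕ, envG Gs (shiftEnv p y) k = envG Gs y (p + k) := fun k => by
    simp only [envG, shiftEnv, Nat.cast_add, add_comm]
  simp only [hEnv, PhiFK, Qmeas_shiftEnv, hG, add_comm _ p, add_zero]

end Environment

universe u v

/-- Proposition p:cv-Qinfini-hy: in the random environment setting,
`Q̄^y_{p,∞}(1)` is exponentially close to `h^{θ^p(y)}`, uniformly in the environment;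
the constant c depends only on a, λ, g. -/
theorem statement_8 (a lam g : ℝ) (hlam : 0 < lam) :
    ∃ c : ℝ, ∀ (S : Type u) [MeasurableSpace S]
      (E : Type v) [MeasurableSpace E] [TopologicalSpace E] [PolishSpace E]
      [BorelSpace E] [Nonempty E]
      (Ms : S → Kernel E E), (∀ s, IsMarkovKernel (Ms s)) →
      ∀ Gs : S → E → ℝ, (∀ s, Measurable (Gs s)) →
      ∀ η0 : Measure E, IsProbabilityMeasure η0 →
      (∀ s x, 0 < Gs s x) → (∀ s x y', Gs s x ≤ g * Gs s y') →
      (∀ y : ℤ → S, ∀ p n : ℕ, p ≤ n → ∀ μ ν : Measure E, IsProbabilityMeasure μ →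
        IsProbabilityMeasure ν →
        tvDist (Measure.bind μ (PFK (envM Ms y) (envG Gs y) p n))
            (Measure.bind ν (PFK (envM Ms y) (envG Gs y) p n)) ≤
          a * Real.exp (-lam * ((n : ℝ) - p)) * tvDist μ ν) →
      ∀ ηinf : (ℤ → S) → Measure E, (∀ y, IsProbabilityMeasure (ηinf y)) →
      (∀ (y : ℤ → S) (n : ℕ),
        PhiFK (envM Ms y) (envG Gs y) 0 n (ηinf y) = ηinf (shiftEnv (n : ℤ) y)) →
      (∀ (y : ℤ → S) (n : ℕ) (μ : Measure E), IsProbabilityMeasure μ →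
        tvDist (PhiFK (envM Ms (shiftEnv (-(n : ℤ)) y)) (envG Gs (shiftEnv (-(n : ℤ)) y)) 0 n μ)
            (ηinf y) ≤ a * Real.exp (-lam * n)) →
      ∀ (y : ℤ → S) (p : ℕ) (x : E),
        |QbarInfEnv Ms Gs η0 y p x - hEnv Ms Gs ηinf (shiftEnv (p : ℤ) y) x| ≤
          c * Real.exp (-lam * p) := by
  set r := Real.exp (-lam) with hr_def
  have hr : 0 ≤ r := (Real.exp_pos _).le
  have hr1 : r < 1 := by simpa [hr_def] using hlam
  refine ⟨2 * (g * a * (1 - r)⁻¹) * Real.exp (g * a * (1 - r)⁻¹) ^ 2 * a, ?_⟩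
  intro S _ E _ _ _ _ _ Ms hMs Gs hGs η0 _ hpos hle hcontr ηinf hprob _ hconv y p x
  have hmodel : IsBoundedModel (envM Ms y) (envG Gs y) g :=
    ⟨fun n => hMs _, fun n => hGs _, fun n => hpos _, fun n => hle _⟩
  have hg : 0 ≤ g := by
    by_contra hneg
    nlinarith [hle (y 0) x x, hpos (y 0) x]
  have ha : 0 ≤ a := by
    simpa using (tvDist_nonneg _ _).trans (hconv y 0 η0 inferInstance)
  have hc : IsContracting (envM Ms y) (envG Gs y) a r := by
    intro q k μ ν hμ hν
    have h := hcontr y q (q + k) (Nat.le_add_right q k) μ ν hμ hν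
    rwa [Nat.cast_add, add_sub_cancel_left, mul_comm (-lam), Real.exp_nat_mul] at h
  have hη : IsProbabilityMeasure (etaFK (envM Ms y) (envG Gs y) η0 p) :=
    isProbabilityMeasure_PhiFK hmodel 0 p η0
  have htv : tvDist (etaFK (envM Ms y) (envG Gs y) η0 p) (ηinf (shiftEnv p y))
      ≤ a * Real.exp (-lam * p) := by
    have h := hconv (shiftEnv p y) p η0 inferInstance
    rwa [shiftEnv_neg_shiftEnv] at h
  have := hprob (shiftEnv p y)
  rw [hEnv_shiftEnv, QbarInfEnv]
  refine (abs_exp_tsum_sub_le hmodel hc ha hg hr hr1 p x _ _).trans ?_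
  have h1r : 0 ≤ (1 - r)⁻¹ := inv_nonneg.mpr (sub_nonneg.mpr hr1.le)
  rw [mul_assoc _ a (Real.exp _)]
  exact mul_le_mul_of_nonneg_left htv (by positivity)

end FKCLT
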